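/- Consider a sequence of models indexed by n in which X_1,…,X_n are i.i.d. N(μ_n, Σ_n) in ℝ^{d_n}, with: (b) universal constants λ_*, λ^* > 0 such that λ_* ≤ λ_1(Σ_n) ≤ ⋯ ≤ λ_{d_n}(Σ_n) ≤ λ^*; (c) μ_nᵀμ_n = O(√d_n / n); (d) d_n/n → τ ∈ (0,∞); (e) m_1/n → κ ∈ (0,1). Then E_P[φ_mean] = Φ( z_α + n √(κ(1−κ)) μ_nᵀμ_n / √tr(Σ_n²) ) + o(1) as n → ∞, where φ_mean = 1{ T_mean > z_{1−α} }. In particular the asymptotic power is maximized when κ = 1/2. -/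

import Mathlib

/-!
Statement 2: Asymptotic power expression for the cross mean test (Theorem 3 of
Kim & Ramdas).  For a sequence of Gaussian models `N(μ_n, Σ_n)` on `ℝ^{d_n}` with
uniformly bounded eigenvalues, local alternatives `μ_nᵀμ_n = O(√d_n/n)`,
`d_n/n → τ ∈ (0,∞)` and `m₁/n → κ ∈ (0,1)`, the power of `φ_mean = 1{T_mean > z_{1−α}}`
satisfies `E[φ_mean] = Φ(z_α + n√(κ(1−κ))·μ_nᵀμ_n/√tr(Σ_n²)) + o(1)`; in particular the
factor `√(κ(1−κ))` (hence the asymptotic power) is maximized at `κ = 1/2`.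
-/

open MeasureTheory ProbabilityTheory Filter

noncomputable section

/-- Euclidean dot product on `Fin d → ℝ`. -/
def dot {d : ℕ} (x y : Fin d → ℝ) : ℝ := ∑ i, x i * y i

/-- Studentized statistic of a sample of reals. -/
def studentized (m : ℕ) (y : Fin m → ℝ) : ℝ :=
  Real.sqrt m * ((∑ i, y i) / m) /
    Real.sqrt ((∑ i, (y i - (∑ j, y j) / m) ^ 2) / m)

/-- Standard normal cumulative distribution function. -/
def Φ (z : ℝ) : ℝ := ∫ t in Set.Iic z, Real.exp (-t ^ 2 / 2) / Real.sqrt (2 * Real.pi)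

/-- The studentized cross mean statistic. -/
def Tmean (d m₁ m₂ : ℕ) (ω : Fin (m₁ + m₂) → Fin d → ℝ) : ℝ :=
  studentized m₁ fun i =>
    dot (fun j => (∑ k : Fin m₂, ω (Fin.natAdd m₁ k) j) / m₂) (ω (Fin.castAdd m₂ i))

/-- `P` is the multivariate Gaussian distribution on `ℝ^d` with mean `μv` and (symmetric)
covariance matrix `S`: every linear image `uᵀX` is Gaussian with mean `uᵀμv` and
variance `uᵀSu`. -/
def IsGaussianVec {d : ℕ} (P : Measure (Fin d → ℝ)) (μv : Fin d → ℝ)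
    (S : Matrix (Fin d) (Fin d) ℝ) : Prop :=
  IsProbabilityMeasure P ∧ S.IsSymm ∧
  ∀ u : Fin d → ℝ,
    P.map (fun x => dot u x) = gaussianReal (dot u μv) (Real.toNNReal (dot u (S.mulVec u)))

set_option linter.unusedSectionVars false

lemma MeasureTheory.Integrable.fun_sub {Ω : Type*} [MeasurableSpace Ω] {P : Measure Ω} {f g : Ω → ℝ}
    (hf : Integrable f P) (hg : Integrable g P) : Integrable (fun ω => f ω - g ω) P := hf.sub hg

lemma Phi_eq (z : ℝ) : Φ z = (gaussianReal 0 1).real (Set.Iic z) := by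
  rw [measureReal_def, gaussianReal_apply_eq_integral 0 one_ne_zero,
    ENNReal.toReal_ofReal (integral_nonneg fun x => gaussianPDFReal_nonneg _ _ _)]
  unfold Φ
  congr 1
  ext t
  simp [gaussianPDFReal]
  ring

lemma gauss_Ioc_le (a b : ℝ) (hab : a ≤ b) : (gaussianReal 0 1).real (Set.Ioc a b) ≤ b - a := by
  rw [measureReal_def, gaussianReal_apply_eq_integral 0 one_ne_zero,
    ENNReal.toReal_ofReal (integral_nonneg fun x => gaussianPDFReal_nonneg _ _ _)]
  have h : ∀ x, gaussianPDFReal 0 1 x ≤ 1 := by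
    intro x
    simp only [gaussianPDFReal]
    have h1 : Real.exp (-(x - 0) ^ 2 / (2 * ((1 : NNReal) : ℝ))) ≤ 1 := by
      apply Real.exp_le_one_iff.2
      have := sq_nonneg x
      norm_num
      nlinarith
    have h2 : (√(2 * Real.pi * ((1 : NNReal) : ℝ)))⁻¹ ≤ 1 := by
      apply inv_le_one_of_one_le₀
      rw [Real.one_le_sqrt]
      have := Real.pi_gt_three
      norm_num
      linarith
    calc _ ≤ (1:ℝ) * 1 := by gcongr
      _ = 1 := by norm_num
  calc _ ≤ ∫ x in Set.Ioc a b, (1:ℝ) := by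
        apply integral_mono
        · exact (integrable_gaussianPDFReal 0 1).integrableOn
        · simp
        · exact h
    _ = b - a := by simp [hab]

lemma Phi_sub (a b : ℝ) (hab : a ≤ b) : Φ b - Φ a = (gaussianReal 0 1).real (Set.Ioc a b) := by
  rw [Phi_eq, Phi_eq, ← Set.Iic_union_Ioc_eq_Iic hab, measureReal_union _ measurableSet_Ioc]
  · ring
  · rw [Set.disjoint_left]
    intro x hx hx'
    exact absurd hx (not_le.2 hx'.1)

lemma Phi_mono : Monotone Φ := by
  intro a b hab
  have := Phi_sub a b hab
  have h2 : 0 ≤ (gaussianReal 0 1).real (Set.Ioc a b) := measureReal_nonneg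
  linarith

lemma Phi_lip (a b : ℝ) : |Φ a - Φ b| ≤ |a - b| := by
  wlog h : b ≤ a generalizing a b
  · rw [abs_sub_comm, abs_sub_comm a]
    exact this b a (le_of_not_ge h)
  · rw [Phi_sub b a h, abs_of_nonneg measureReal_nonneg, abs_of_nonneg (by linarith)]
    exact gauss_Ioc_le b a h

lemma Phi_strict (a b : ℝ) (h : a < b) : Φ a < Φ b := by
  have h1 := Phi_sub a b h.le
  have : 0 < (gaussianReal 0 1).real (Set.Ioc a b) := by
    rw [measureReal_def]
    apply ENNReal.toReal_pos _ (measure_ne_top _ _)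
    intro h0
    have := gaussianReal_absolutelyContinuous' 0 (one_ne_zero (α := NNReal)) h0
    simp at this
    linarith
  linarith

lemma gauss_Ioi (z : ℝ) : (gaussianReal 0 1).real (Set.Ioi z) = Φ (-z) := by
  have h := gaussianReal_map_neg (μ := 0) (v := 1)
  rw [neg_zero] at h
  have hn := nullSingletonClass_gaussianReal (μ := 0) (one_ne_zero (α := NNReal))
  rw [Phi_eq, measureReal_def, measureReal_def]
  congr 1
  conv_lhs => rw [← h]
  rw [Measure.map_apply (by fun_prop) measurableSet_Ioi]
  have : (fun x : ℝ => -x) ⁻¹' Set.Ioi z = Set.Iio (-z) := by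
    ext x; simp
  rw [this]
  exact measure_congr Iio_ae_eq_Iic

lemma Phi_neg (z : ℝ) : Φ (-z) = 1 - Φ z := by
  rw [← gauss_Ioi, Phi_eq, ← Set.compl_Iic, probReal_compl_eq_one_sub measurableSet_Iic]

lemma quant_neg (α z1a za : ℝ) (hz1 : Φ z1a = 1 - α) (hza : Φ za = α) : za = - z1a := by
  have h : Φ (-z1a) = Φ za := by rw [Phi_neg, hz1, hza]; ring
  rcases lt_trichotomy za (-z1a) with h1 | h1 | h1
  · have := Phi_strict _ _ h1; linarith
  · exact h1
  · have := Phi_strict _ _ h1; linarith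

lemma gauss_fourth (v : NNReal) : ∫ x, x ^ 4 ∂(gaussianReal 0 v) = 3 * (v:ℝ) ^ 2 := by
  have h0 : ∫ x, x ^ 4 ∂(gaussianReal 0 v) = iteratedDeriv 4 (mgf id (gaussianReal 0 v)) 0 := by
    rw [iteratedDeriv_mgf_zero] <;> simp
  rw [h0, mgf_id_gaussianReal]
  generalize (v : ℝ) = w
  have hd : ∀ (p p' : ℝ → ℝ), (∀ t, HasDerivAt p (p' t) t) →
      deriv (fun t => p t * Real.exp (w * t ^ 2 / 2)) =
        fun t => (p' t + p t * (w * t)) * Real.exp (w * t ^ 2 / 2) := by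
    intro p p' hp
    ext t
    have h1 : HasDerivAt (fun t : ℝ => w * t ^ 2 / 2) (w * t) t :=
      (((hasDerivAt_pow 2 t).const_mul w).div_const 2).congr_deriv (by norm_num; ring)
    have := (hp t).mul h1.exp
    refine (this.deriv).trans ?_
    ring
  have e0 : (fun t : ℝ => Real.exp (0 * t + w * t ^ 2 / 2)) =
      fun t => (fun _ => 1) t * Real.exp (w * t ^ 2 / 2) := by ext t; simp
  rw [e0, iteratedDeriv_succ', hd (fun _ => 1) (fun _ => 0) (fun t => hasDerivAt_const t 1),
    iteratedDeriv_succ', hd (fun t => 0 + 1 * (w * t)) (fun t => w), iteratedDeriv_succ',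
    hd (fun t => w + (0 + 1 * (w * t)) * (w * t)) (fun t => 2 * w ^ 2 * t), iteratedDeriv_succ',
    hd (fun t => 2 * w ^ 2 * t + (w + (0 + 1 * (w * t)) * (w * t)) * (w * t))
      (fun t => 3 * w ^ 2 + 3 * w ^ 3 * t ^ 2)]
  · norm_num
  · intro t
    have h1 := (((hasDerivAt_id t).const_mul (3 * w ^ 2)).add
      ((hasDerivAt_pow 3 t).const_mul (w ^ 3)))
    have e : (fun t => 2 * w ^ 2 * t + (w + (0 + 1 * (w * t)) * (w * t)) * (w * t)) =
      (fun y => 3 * w ^ 2 * id y) + fun y => w ^ 3 * y ^ 3 := by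
      funext x; simp only [Pi.add_apply, id]; ring
    rw [e]
    exact h1.congr_deriv (by norm_num; ring)
  · intro t
    have h1 := (((hasDerivAt_pow 2 t).const_mul (w ^ 2)).const_add w)
    have e : (fun t => w + (0 + 1 * (w * t)) * (w * t)) = fun x => w + w ^ 2 * x ^ 2 := by
      funext x; ring
    rw [e]
    exact h1.congr_deriv (by norm_num; ring)
  · intro t
    have h1 := (((hasDerivAt_id t).const_mul w))
    have e : (fun t => 0 + 1 * (w * t)) = fun y => w * id y := by
      funext x; simp only [id]; ring
    rw [e]
    exact h1.congr_deriv (by norm_num)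

lemma gauss_second (v : NNReal) : ∫ x, x ^ 2 ∂(gaussianReal 0 v) = v := by
  have h := variance_fun_id_gaussianReal (μ := 0) (v := v)
  rw [variance_eq_integral (by fun_prop)] at h
  simpa using h

lemma gauss_int_pow (v : NNReal) (k : ℕ) : Integrable (fun x => x ^ k) (gaussianReal 0 v) := by
  have := (memLp_id_gaussianReal (μ := 0) (v := v) (k : NNReal)).integrable_norm_pow'
  refine this.mono' (by fun_prop) ?_
  simp

section quad
variable {Ω : Type*} [MeasurableSpace Ω] {P : Measure Ω} [IsProbabilityMeasure P]

lemma law_int {X : Ω → ℝ} (hX : Measurable X) {v : NNReal} (h : P.map X = gaussianReal 0 v) (k : ℕ) :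
    Integrable (fun ω => X ω ^ k) P := by
  have := gauss_int_pow v k
  rw [← h] at this
  exact (integrable_map_measure (continuous_pow k).aestronglyMeasurable hX.aemeasurable).1 this

lemma law_fourth {X : Ω → ℝ} (hX : Measurable X) {v : NNReal} (h : P.map X = gaussianReal 0 v) :
    ∫ ω, X ω ^ 4 ∂P = 3 * (v:ℝ) ^ 2 := by
  rw [← gauss_fourth, ← h, integral_map hX.aemeasurable (by fun_prop)]

lemma law_second {X : Ω → ℝ} (hX : Measurable X) {v : NNReal} (h : P.map X = gaussianReal 0 v) :
    ∫ ω, X ω ^ 2 ∂P = v := by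
  rw [← gauss_second, ← h, integral_map hX.aemeasurable (by fun_prop)]

lemma cross_cov {X Y : Ω → ℝ} (hX : Measurable X) (hY : Measurable Y) {v w : NNReal}
    (h1 : P.map X = gaussianReal 0 v) (h2 : P.map Y = gaussianReal 0 w)
    (h3 : P.map (fun ω => X ω + Y ω) = gaussianReal 0 (v + w))
    (h4 : P.map (fun ω => X ω - Y ω) = gaussianReal 0 (v + w)) :
    Integrable (fun ω => (X ω ^ 2 - v) * (Y ω ^ 2 - w)) P ∧
      ∫ ω, (X ω ^ 2 - v) * (Y ω ^ 2 - w) ∂P = 0 := by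
  have e : (fun ω => (X ω ^ 2 - v) * (Y ω ^ 2 - w)) = fun ω =>
      (1 / 12) * (X ω + Y ω) ^ 4 + (1 / 12) * (X ω - Y ω) ^ 4 - (1 / 6) * X ω ^ 4 - (1 / 6) * Y ω ^ 4
        - v * Y ω ^ 2 - w * X ω ^ 2 + v * w := by
    ext ω; ring
  have i1 : Integrable (fun ω => (1 / 12) * (X ω + Y ω) ^ 4) P := (law_int (hX.add hY) h3 4).const_mul (1 / 12)
  have i2 : Integrable (fun ω => (1 / 12) * (X ω - Y ω) ^ 4) P := (law_int (hX.sub hY) h4 4).const_mul (1 / 12)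
  have i3 := (law_int hX h1 4).const_mul (1 / 6)
  have i4 := (law_int hY h2 4).const_mul (1 / 6)
  have i5 := (law_int hY h2 2).const_mul v
  have i6 := (law_int hX h1 2).const_mul w
  have i7 : Integrable (fun _ : Ω => (v:ℝ) * w) P := integrable_const _
  rw [e]
  refine ⟨(((((i1.fun_add i2).fun_sub i3).fun_sub i4).fun_sub i5).fun_sub i6).fun_add i7, ?_⟩
  rw [integral_add (((((i1.fun_add i2).fun_sub i3).fun_sub i4).fun_sub i5).fun_sub i6) i7,
    integral_sub ((((i1.fun_add i2).fun_sub i3).fun_sub i4).fun_sub i5) i6,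
    integral_sub (((i1.fun_add i2).fun_sub i3).fun_sub i4) i5,
    integral_sub ((i1.fun_add i2).fun_sub i3) i4,
    integral_sub (i1.fun_add i2) i3, integral_add i1 i2]
  simp only [integral_const_mul]
  rw [law_fourth (X := fun ω => X ω + Y ω) (hX.add hY) h3, law_fourth (X := fun ω => X ω - Y ω) (hX.sub hY) h4, law_fourth hX h1, law_fourth hY h2,
    law_second hX h1, law_second hY h2]
  simp
  ring

lemma diag_cov {X : Ω → ℝ} (hX : Measurable X) {v : NNReal}
    (h1 : P.map X = gaussianReal 0 v) :
    Integrable (fun ω => (X ω ^ 2 - v) * (X ω ^ 2 - v)) P ∧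
      ∫ ω, (X ω ^ 2 - v) * (X ω ^ 2 - v) ∂P = 2 * (v:ℝ) ^ 2 := by
  have e : (fun ω => (X ω ^ 2 - v) * (X ω ^ 2 - v)) = fun ω =>
      X ω ^ 4 - 2 * v * X ω ^ 2 + v * v := by
    ext ω; ring
  have i3 := (law_int hX h1 4)
  have i6 := (law_int hX h1 2).const_mul (2 * v)
  have i7 : Integrable (fun _ : Ω => (v:ℝ) * v) P := integrable_const _
  rw [e]
  refine ⟨(i3.fun_sub i6).fun_add i7, ?_⟩
  rw [integral_add (i3.fun_sub i6) i7, integral_sub i3 i6]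
  simp only [integral_const_mul]
  rw [law_fourth hX h1, law_second hX h1]
  simp
  ring

lemma quad_var {d : ℕ} (ξ : Fin d → Ω → ℝ) (hξ : ∀ i, Measurable (ξ i)) (v : Fin d → NNReal)
    (c : Fin d → ℝ)
    (h1 : ∀ i, P.map (ξ i) = gaussianReal 0 (v i))
    (h3 : ∀ i j, i ≠ j → P.map (fun ω => ξ i ω + ξ j ω) = gaussianReal 0 (v i + v j))
    (h4 : ∀ i j, i ≠ j → P.map (fun ω => ξ i ω - ξ j ω) = gaussianReal 0 (v i + v j)) :
    Integrable (fun ω => (∑ i, c i * ξ i ω ^ 2 - ∑ i, c i * v i) ^ 2) P ∧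
    ∫ ω, (∑ i, c i * ξ i ω ^ 2 - ∑ i, c i * v i) ^ 2 ∂P = 2 * ∑ i, c i ^ 2 * (v i : ℝ) ^ 2 := by
  have e : (fun ω => (∑ i, c i * ξ i ω ^ 2 - ∑ i, c i * v i) ^ 2) = fun ω =>
      ∑ i, ∑ j, c i * c j * ((ξ i ω ^ 2 - v i) * (ξ j ω ^ 2 - v j)) := by
    ext ω
    rw [← Finset.sum_sub_distrib, sq, Finset.sum_mul_sum]
    refine Finset.sum_congr rfl fun i _ => Finset.sum_congr rfl fun j _ => ?_
    ring
  have hI : ∀ i j, Integrable (fun ω => c i * c j * ((ξ i ω ^ 2 - v i) * (ξ j ω ^ 2 - v j))) P := by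
    intro i j
    apply Integrable.const_mul
    by_cases h : i = j
    · subst h; exact (diag_cov (hξ i) (h1 i)).1
    · exact (cross_cov (hξ i) (hξ j) (h1 i) (h1 j) (h3 i j h) (h4 i j h)).1
  rw [e]
  refine ⟨integrable_finsetSum _ fun i _ => integrable_finsetSum _ fun j _ => hI i j, ?_⟩
  rw [integral_finsetSum _ fun i _ => integrable_finsetSum _ fun j _ => hI i j, Finset.mul_sum]
  refine Finset.sum_congr rfl fun i _ => ?_
  rw [integral_finsetSum _ fun j _ => hI i j, Finset.sum_eq_single i]
  · rw [integral_const_mul, (diag_cov (hξ i) (h1 i)).2]; ring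
  · intro j _ hj
    rw [integral_const_mul, (cross_cov (hξ i) (hξ j) (h1 i) (h1 j) (h3 i j hj.symm) (h4 i j hj.symm)).2,
      mul_zero]
  · simp

lemma cheb {X : Ω → ℝ} (hI : Integrable (fun ω => X ω ^ 2) P) {B : ℝ}
    (hB : ∫ ω, X ω ^ 2 ∂P ≤ B) {ε : ℝ} (hε : 0 < ε) :
    P.real {ω | ε ≤ |X ω|} ≤ B / ε ^ 2 := by
  have h := mul_meas_ge_le_integral_of_nonneg (μ := P) (f := fun ω => X ω ^ 2)
    (ae_of_all _ fun ω => sq_nonneg _) hI (ε ^ 2)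
  have e : {ω | ε ^ 2 ≤ X ω ^ 2} = {ω | ε ≤ |X ω|} := by
    ext ω
    simp only [Set.mem_ofPred_eq]
    rw [← sq_abs (X ω)]
    exact pow_le_pow_iff_left₀ hε.le (abs_nonneg _) two_ne_zero
  rw [e] at h
  rw [le_div_iff₀ (by positivity)]
  linarith
end quad

set_option linter.unusedVariables false

lemma pi_lin {m : ℕ} {E : Type*} [MeasurableSpace E] (Q : Fin m → Measure E)
    [∀ k, IsProbabilityMeasure (Q k)] (f : Fin m → E → ℝ) (hf : ∀ k, Measurable (f k))
    (a : Fin m → ℝ) (v : Fin m → NNReal)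
    (h : ∀ k, (Q k).map (f k) = gaussianReal (a k) (v k)) :
    (Measure.pi Q).map (fun ω => ∑ k, f k (ω k)) = gaussianReal (∑ k, a k) (∑ k, v k) := by
  have hm : Measurable (fun ω : Fin m → E => ∑ k, f k (ω k)) := by fun_prop
  have : IsProbabilityMeasure ((Measure.pi Q).map (fun ω => ∑ k, f k (ω k))) :=
    Measure.isProbabilityMeasure_map hm.aemeasurable
  apply Measure.ext_of_charFun
  have hind : iIndepFun (fun k (ω : Fin m → E) => f k (ω k)) (Measure.pi Q) :=
    iIndepFun_pi fun k => (hf k).aemeasurable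
  have hmk : ∀ k, AEMeasurable (fun ω : Fin m → E => f k (ω k)) (Measure.pi Q) :=
    fun k => ((hf k).comp (measurable_pi_apply k)).aemeasurable
  rw [hind.charFun_map_fun_sum_eq_prod hmk]
  ext t
  rw [Finset.prod_apply, charFun_gaussianReal]
  have h2 : ∀ k, (Measure.pi Q).map (fun ω : Fin m → E => f k (ω k)) = gaussianReal (a k) (v k) := by
    intro k
    rw [← h k, ← (measurePreserving_eval Q k).map_eq, Measure.map_map (hf k) (by fun_prop)]
    rfl
  simp_rw [h2, charFun_gaussianReal]
  rw [← Complex.exp_sum]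
  congr 1
  push_cast
  rw [Finset.sum_sub_distrib, Finset.mul_sum, Finset.sum_mul, Finset.sum_mul, Finset.sum_div]

lemma split_map {E : Type*} [MeasurableSpace E] (P : Measure E) [IsProbabilityMeasure P] (m₁ m₂ : ℕ) :
    ((Measure.pi fun _ : Fin m₂ => P).prod (Measure.pi fun _ : Fin m₁ => P)).map
      (fun p => Fin.append p.2 p.1) = Measure.pi fun _ : Fin (m₁ + m₂) => P := by
  have hmeas : Measurable (fun p : (Fin m₂ → E) × (Fin m₁ → E) => Fin.append p.2 p.1) := by
    rw [measurable_pi_iff]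
    intro i
    refine Fin.addCases (fun j => ?_) (fun j => ?_) i
    · simp only [Fin.append_left]; fun_prop
    · simp only [Fin.append_right]; fun_prop
  refine (Measure.pi_eq fun s hs => ?_).symm
  rw [Measure.map_apply hmeas (MeasurableSet.univ_pi hs)]
  have : (fun p : (Fin m₂ → E) × (Fin m₁ → E) => Fin.append p.2 p.1) ⁻¹' (Set.univ.pi s) =
      (Set.univ.pi fun k => s (Fin.natAdd m₁ k)) ×ˢ (Set.univ.pi fun k => s (Fin.castAdd m₂ k)) := by
    ext p
    simp only [Set.mem_preimage, Set.mem_pi, Set.mem_univ, forall_const, Set.mem_prod]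
    constructor
    · intro h
      exact ⟨fun k => by simpa using h (Fin.natAdd m₁ k), fun k => by simpa using h (Fin.castAdd m₂ k)⟩
    · rintro ⟨h1, h2⟩ i
      refine Fin.addCases (fun j => ?_) (fun j => ?_) i
      · simpa using h2 j
      · simpa using h1 j
  rw [this, Measure.prod_prod, Measure.pi_pi, Measure.pi_pi, Fin.prod_univ_add, mul_comm]

lemma spec {d : ℕ} (S : Matrix (Fin d) (Fin d) ℝ) (hS : S.IsSymm) :
    ∃ (u : Fin d → Fin d → ℝ) (l : Fin d → ℝ),
      (∀ i j, dot (u i) (u j) = if i = j then 1 else 0) ∧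
      (∀ x, dot x (S.mulVec x) = ∑ i, l i * (dot (u i) x) ^ 2) ∧
      (∀ x, dot x x = ∑ i, (dot (u i) x) ^ 2) ∧
      Matrix.trace (S * S) = ∑ i, l i ^ 2 := by
  have hH : S.IsHermitian := by
    rw [Matrix.IsHermitian, Matrix.conjTranspose_eq_transpose_of_trivial]; exact hS
  set U : Matrix (Fin d) (Fin d) ℝ := (hH.eigenvectorUnitary : Matrix.unitaryGroup (Fin d) ℝ).1 with hU
  have h1 : U.transpose * U = 1 := by
    have := Unitary.coe_star_mul_self hH.eigenvectorUnitary
    rwa [Matrix.star_eq_conjTranspose, Matrix.conjTranspose_eq_transpose_of_trivial] at this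
  have h2 : U * U.transpose = 1 := mul_eq_one_comm.1 h1
  have h3 : S = U * Matrix.diagonal hH.eigenvalues * U.transpose := by
    have := hH.spectral_theorem
    rw [Unitary.conjStarAlgAut_apply] at this
    simpa [Matrix.star_eq_conjTranspose, Matrix.conjTranspose_eq_transpose_of_trivial] using! this
  have hdot : ∀ x y : Fin d → ℝ, dot x y = x ⬝ᵥ y := fun x y => rfl
  have hu : ∀ i x, dot (fun j => U j i) x = (U.transpose.mulVec x) i := fun i x => rfl
  refine ⟨fun i j => U j i, hH.eigenvalues, ?_, ?_, ?_, ?_⟩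
  · intro i j
    have := congrFun (congrFun h1 i) j
    rw [Matrix.one_apply] at this
    rw [← this]; rfl
  · intro x
    simp_rw [hu]
    rw [hdot]
    conv_lhs => rw [h3]
    rw [← Matrix.mulVec_mulVec, ← Matrix.mulVec_mulVec, Matrix.dotProduct_mulVec,
      ← Matrix.mulVec_transpose]
    simp only [dotProduct, Matrix.mulVec_diagonal]
    exact Finset.sum_congr rfl fun i _ => by ring
  · intro x
    simp_rw [hu]
    rw [hdot]
    have : x = U.mulVec (U.transpose.mulVec x) := by rw [Matrix.mulVec_mulVec, h2, Matrix.one_mulVec]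
    conv_lhs => rw [this]
    rw [Matrix.dotProduct_mulVec, ← Matrix.mulVec_transpose, Matrix.mulVec_mulVec, h1,
      Matrix.one_mulVec]
    simp only [dotProduct]
    exact Finset.sum_congr rfl fun i _ => by ring
  · have : S * S = U * (Matrix.diagonal hH.eigenvalues * Matrix.diagonal hH.eigenvalues
        * U.transpose) := by
      conv_lhs => rw [h3]
      calc _ = U * (Matrix.diagonal hH.eigenvalues * (U.transpose * U) *
          Matrix.diagonal hH.eigenvalues * U.transpose) := by simp only [Matrix.mul_assoc]
        _ = _ := by rw [h1, Matrix.mul_one]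
    rw [this, Matrix.trace_mul_comm, Matrix.mul_assoc, h1, Matrix.mul_one,
      Matrix.diagonal_mul_diagonal, Matrix.trace_diagonal]
    exact Finset.sum_congr rfl fun i _ => by ring

lemma dot_add_left {d : ℕ} (x y z : Fin d → ℝ) : dot (x + y) z = dot x z + dot y z :=
  add_dotProduct x y z
lemma dot_sub_left {d : ℕ} (x y z : Fin d → ℝ) : dot (x - y) z = dot x z - dot y z :=
  sub_dotProduct x y z
lemma dot_add_right {d : ℕ} (x y z : Fin d → ℝ) : dot x (y + z) = dot x y + dot x z :=
  dotProduct_add x y z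
lemma dot_sub_right {d : ℕ} (x y z : Fin d → ℝ) : dot x (y - z) = dot x y - dot x z :=
  dotProduct_sub x y z
lemma dot_smul_right {d : ℕ} (c : ℝ) (x y : Fin d → ℝ) : dot x (c • y) = c * dot x y :=
  dotProduct_smul c x y
lemma dot_smul_left {d : ℕ} (c : ℝ) (x y : Fin d → ℝ) : dot (c • x) y = c * dot x y :=
  smul_dotProduct c x y
lemma dot_comm' {d : ℕ} (x y : Fin d → ℝ) : dot x y = dot y x :=
  dotProduct_comm x y

lemma dot_meas {d : ℕ} (u : Fin d → ℝ) : Measurable (fun x => dot u x) := by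
  unfold dot; fun_prop

/-- eigenvalue bounds package -/
lemma spec_bd {d : ℕ} (S : Matrix (Fin d) (Fin d) ℝ) (hS : S.IsSymm) (lo hi : ℝ) (hlo : 0 < lo)
    (heig : ∀ u : Fin d → ℝ, dot u u = 1 → lo ≤ dot u (S.mulVec u) ∧ dot u (S.mulVec u) ≤ hi) :
    ∃ (u : Fin d → Fin d → ℝ) (l : Fin d → ℝ),
      (∀ i j, dot (u i) (u j) = if i = j then 1 else 0) ∧
      (∀ x, dot x (S.mulVec x) = ∑ i, l i * (dot (u i) x) ^ 2) ∧
      (∀ x, dot x x = ∑ i, (dot (u i) x) ^ 2) ∧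
      Matrix.trace (S * S) = ∑ i, l i ^ 2 ∧ ∀ i, lo ≤ l i ∧ l i ≤ hi := by
  obtain ⟨u, l, h1, h2, h3, h4⟩ := spec S hS
  refine ⟨u, l, h1, h2, h3, h4, fun i => ?_⟩
  have h5 := heig (u i) (by simp [h1])
  have h6 : dot (u i) (S.mulVec (u i)) = l i := by
    rw [h2]; simp [h1]
  rwa [h6] at h5

lemma form_bd {d : ℕ} (S : Matrix (Fin d) (Fin d) ℝ) (hS : S.IsSymm) (lo hi : ℝ) (hlo : 0 < lo)
    (heig : ∀ u : Fin d → ℝ, dot u u = 1 → lo ≤ dot u (S.mulVec u) ∧ dot u (S.mulVec u) ≤ hi)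
    (x : Fin d → ℝ) : 0 ≤ dot x (S.mulVec x) ∧ dot x (S.mulVec x) ≤ hi * dot x x := by
  obtain ⟨u, l, h1, h2, h3, h4, h5⟩ := spec_bd S hS lo hi hlo heig
  rw [h2, h3, Finset.mul_sum]
  constructor
  · exact Finset.sum_nonneg fun i _ => mul_nonneg (hlo.le.trans (h5 i).1) (sq_nonneg _)
  · exact Finset.sum_le_sum fun i _ => mul_le_mul_of_nonneg_right (h5 i).2 (sq_nonneg _)

lemma trace_bd {d : ℕ} (S : Matrix (Fin d) (Fin d) ℝ) (hS : S.IsSymm) (lo hi : ℝ) (hlo : 0 < lo)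
    (heig : ∀ u : Fin d → ℝ, dot u u = 1 → lo ≤ dot u (S.mulVec u) ∧ dot u (S.mulVec u) ≤ hi) :
    d * lo ^ 2 ≤ Matrix.trace (S * S) ∧ Matrix.trace (S * S) ≤ d * hi ^ 2 := by
  obtain ⟨u, l, h1, h2, h3, h4, h5⟩ := spec_bd S hS lo hi hlo heig
  rw [h4]
  constructor
  · calc (d : ℝ) * lo ^ 2 = ∑ i : Fin d, lo ^ 2 := by simp
      _ ≤ _ := Finset.sum_le_sum fun i _ => pow_le_pow_left₀ hlo.le (h5 i).1 2
  · calc _ ≤ ∑ i : Fin d, hi ^ 2 :=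
          Finset.sum_le_sum fun i _ => pow_le_pow_left₀ (hlo.le.trans (h5 i).1) (h5 i).2 2
      _ = (d : ℝ) * hi ^ 2 := by simp

lemma lin_conc {d : ℕ} (S : Matrix (Fin d) (Fin d) ℝ) (L : Measure (Fin d → ℝ))
    (hL : IsGaussianVec L 0 S) (u : Fin d → ℝ) (hu : 0 ≤ dot u (S.mulVec u)) {ε : ℝ} (hε : 0 < ε) :
    L.real {w | ε ≤ |dot u w|} ≤ dot u (S.mulVec u) / ε ^ 2 := by
  obtain ⟨hp, hS, hg⟩ := hL
  have h := hg u
  have h0 : dot u 0 = 0 := dotProduct_zero u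
  rw [h0] at h
  refine cheb (law_int (dot_meas u) h 2) ?_ hε
  rw [law_second (dot_meas u) h, Real.coe_toNNReal _ hu]

lemma quad_conc {d : ℕ} (S : Matrix (Fin d) (Fin d) ℝ) (L : Measure (Fin d → ℝ))
    (hL : IsGaussianVec L 0 S) (lo hi : ℝ) (hlo : 0 < lo)
    (heig : ∀ u : Fin d → ℝ, dot u u = 1 → lo ≤ dot u (S.mulVec u) ∧ dot u (S.mulVec u) ≤ hi)
    {ε : ℝ} (hε : 0 < ε) :
    L.real {w | ε ≤ |dot w (S.mulVec w) - Matrix.trace (S * S)|} ≤ (2 * d * hi ^ 4) / ε ^ 2 := by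
  obtain ⟨hp, hS, hg⟩ := hL
  obtain ⟨u, l, h1, h2, h3, h4, h5⟩ := spec_bd S hS lo hi hlo heig
  have hl : ∀ i, 0 ≤ l i := fun i => hlo.le.trans (h5 i).1
  have hg' : ∀ u, L.map (fun x => dot u x) = gaussianReal 0 (Real.toNNReal (dot u (S.mulVec u))) := by
    intro u
    rw [hg u]; congr 1; exact dotProduct_zero u
  have q1 : ∀ i, dot (u i) (S.mulVec (u i)) = l i := fun i => by rw [h2]; simp [h1]
  have q2 : ∀ i j, i ≠ j → dot (u i + u j) (S.mulVec (u i + u j)) = l i + l j := by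
    intro i j hij
    rw [h2]
    simp_rw [dot_add_right, h1]
    have : ∀ k, l k * ((if k = i then (1:ℝ) else 0) + if k = j then 1 else 0) ^ 2 =
        (if k = i then l k else 0) + if k = j then l k else 0 := by
      intro k
      by_cases h : k = i
      · have : k ≠ j := h ▸ hij
        simp [h, hij]
      · by_cases h' : k = j <;> simp [h, h', hij.symm]
    simp_rw [this, Finset.sum_add_distrib]
    simp
  have q3 : ∀ i j, i ≠ j → dot (u i - u j) (S.mulVec (u i - u j)) = l i + l j := by
    intro i j hij
    rw [h2]
    simp_rw [dot_sub_right, h1]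
    have : ∀ k, l k * ((if k = i then (1:ℝ) else 0) - if k = j then 1 else 0) ^ 2 =
        (if k = i then l k else 0) + if k = j then l k else 0 := by
      intro k
      by_cases h : k = i
      · have : k ≠ j := h ▸ hij
        simp [h, hij]
      · by_cases h' : k = j <;> simp [h, h', hij.symm]
    simp_rw [this, Finset.sum_add_distrib]
    simp
  have key := quad_var (P := L) (fun i w => dot (u i) w) (fun i => dot_meas (u i))
    (fun i => Real.toNNReal (l i)) l ?_ ?_ ?_
  · have e : (fun w => (∑ i, l i * dot (u i) w ^ 2 - ∑ i, l i * ((Real.toNNReal (l i) : NNReal) : ℝ)) ^ 2)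
        = fun w => (dot w (S.mulVec w) - Matrix.trace (S * S)) ^ 2 := by
      ext w
      rw [h2, h4]
      congr 2
      exact Finset.sum_congr rfl fun i _ => by rw [Real.coe_toNNReal _ (hl i)]; ring
    rw [e] at key
    refine cheb key.1 ?_ hε
    rw [key.2, mul_assoc]
    gcongr
    calc _ ≤ ∑ i : Fin d, hi ^ 4 := by
          refine Finset.sum_le_sum fun i _ => ?_
          rw [Real.coe_toNNReal _ (hl i), ← pow_add]
          exact pow_le_pow_left₀ (hl i) (h5 i).2 4
      _ = (d : ℝ) * hi ^ 4 := by simp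
  · intro i; rw [hg', q1]
  · intro i j hij
    have := hg' (u i + u j)
    rw [q2 i j hij, Real.toNNReal_add (hl i) (hl j)] at this
    simpa only [dot_add_left] using this
  · intro i j hij
    have := hg' (u i - u j)
    rw [q3 i j hij, Real.toNNReal_add (hl i) (hl j)] at this
    simpa only [dot_sub_left] using this

/-- the normalized centered mean of the second half -/
def Wfun {d : ℕ} (μ : Fin d → ℝ) (m : ℕ) (ω : Fin m → Fin d → ℝ) : Fin d → ℝ :=
  fun j => (∑ k, (ω k j - μ j)) / Real.sqrt m

lemma Wfun_meas {d : ℕ} (μ : Fin d → ℝ) (m : ℕ) : Measurable (Wfun μ m) := by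
  unfold Wfun; fun_prop

lemma W_law {d : ℕ} (μ : Fin d → ℝ) (S : Matrix (Fin d) (Fin d) ℝ) (P : Measure (Fin d → ℝ))
    (hP : IsGaussianVec P μ S) (hS : ∀ u, 0 ≤ dot u (S.mulVec u)) (m : ℕ) (hm : 0 < m) :
    IsGaussianVec ((Measure.pi fun _ : Fin m => P).map (Wfun μ m)) 0 S := by
  obtain ⟨hp, hSy, hg⟩ := hP
  refine ⟨Measure.isProbabilityMeasure_map (Wfun_meas μ m).aemeasurable, hSy, fun u => ?_⟩
  rw [Measure.map_map (dot_meas u) (Wfun_meas μ m)]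
  have e : ((fun x => dot u x) ∘ Wfun μ m) = fun ω => ∑ k, (dot u (ω k) - dot u μ) / Real.sqrt m := by
    ext ω
    simp only [Function.comp, dot, Wfun]
    simp_rw [← Finset.sum_sub_distrib, Finset.sum_div, Finset.mul_sum]
    rw [Finset.sum_comm]
    refine Finset.sum_congr rfl fun k _ => Finset.sum_congr rfl fun i _ => ?_
    ring
  have hlaw : ∀ k : Fin m, P.map (fun x => (dot u x - dot u μ) / Real.sqrt m) =
      gaussianReal 0 (Real.toNNReal (dot u (S.mulVec u) / m)) := by
    intro _
    have e2 : (fun x => (dot u x - dot u μ) / Real.sqrt m) =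
      (fun t => t / Real.sqrt m) ∘ (fun t => t - dot u μ) ∘ (fun x => dot u x) := rfl
    rw [e2, ← Measure.map_map (by fun_prop) (by have := dot_meas u; fun_prop),
      ← Measure.map_map (by fun_prop) (dot_meas u), hg u, gaussianReal_map_sub_const,
      gaussianReal_map_div_const]
    congr 1
    · simp
    · ext
      push_cast
      rw [Real.coe_toNNReal _ (hS u), Real.coe_toNNReal _ (by have := hS u; positivity)]
      simp
  rw [e, pi_lin (fun _ => P) (fun _ x => (dot u x - dot u μ) / Real.sqrt m)
    (fun _ => by have := dot_meas u; fun_prop) _ _ hlaw]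
  congr 1
  · simp; exact (dotProduct_zero u).symm
  · ext
    push_cast
    rw [Real.coe_toNNReal _ (hS u), Real.coe_toNNReal _ (by have := hS u; positivity)]
    simp
    field_simp

lemma gauss_vec (m : ℕ) :
    IsGaussianVec (Measure.pi fun _ : Fin m => gaussianReal 0 1) 0 (1 : Matrix (Fin m) (Fin m) ℝ) := by
  refine ⟨inferInstance, Matrix.isSymm_one, fun u => ?_⟩
  unfold dot
  rw [pi_lin (fun _ => gaussianReal 0 1) (fun k x => u k * x) (fun k => by fun_prop)
    (fun k => u k * 0) (fun k => .mk (u k ^ 2) (sq_nonneg _) * 1)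
    (fun k => gaussianReal_map_const_mul (u k))]
  congr 1
  ext
  rw [Matrix.one_mulVec, Real.coe_toNNReal _ (Finset.sum_nonneg fun i _ => mul_self_nonneg _)]
  push_cast
  refine Finset.sum_congr rfl fun i _ => ?_
  simp [sq]

/-- sample standard deviation -/
def sdev (m : ℕ) (t : Fin m → ℝ) : ℝ := Real.sqrt ((∑ i, (t i - (∑ j, t j) / m) ^ 2) / m)

lemma sdev_sq (m : ℕ) (hm : 0 < m) (t : Fin m → ℝ) :
    sdev m t ^ 2 = (∑ i, t i ^ 2) / m - ((∑ j, t j) / m) ^ 2 := by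
  have hm' : (m : ℝ) ≠ 0 := by positivity
  unfold sdev
  rw [Real.sq_sqrt (div_nonneg (Finset.sum_nonneg fun i _ => sq_nonneg _) (by positivity))]
  generalize hc : (∑ j, t j) / (m : ℝ) = c
  have h1 : ∑ j, t j = m * c := by rw [← hc]; field_simp
  have : ∑ i, (t i - c) ^ 2 = ∑ i, t i ^ 2 - m * c ^ 2 := by
    have : ∀ i, (t i - c) ^ 2 = t i ^ 2 - 2 * c * t i + c ^ 2 := fun i => by ring
    simp_rw [this]
    rw [Finset.sum_add_distrib, Finset.sum_sub_distrib, ← Finset.mul_sum, h1]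
    simp
    ring
  rw [this]
  field_simp

lemma sdev_conc (m : ℕ) (hm : 0 < m) {ε : ℝ} (hε : 0 < ε) (hε1 : ε < 1) :
    (Measure.pi fun _ : Fin m => gaussianReal 0 1).real {t | ε ≤ |sdev m t - 1|} ≤
      12 / (m * ε ^ 2) := by
  have hm' : (0 : ℝ) < m := by positivity
  have hV := gauss_vec m
  have h1 := quad_conc 1 _ hV 1 1 one_pos
    (fun u hu => by rw [Matrix.one_mulVec, hu]; simp) (ε := m * (ε / 2)) (by positivity)
  have e0 : dot (fun _ : Fin m => 1 / (m : ℝ)) ((1 : Matrix (Fin m) (Fin m) ℝ).mulVec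
      (fun _ : Fin m => 1 / (m : ℝ))) = 1 / m := by
    rw [Matrix.one_mulVec]; simp [dot]; field_simp
  have h2 := lin_conc 1 _ hV (fun _ => 1 / (m : ℝ)) (by rw [e0]; positivity) (ε := ε / 2)
    (by positivity)
  rw [e0] at h2
  have hsub : {t : Fin m → ℝ | ε ≤ |sdev m t - 1|} ⊆
      {w | m * (ε / 2) ≤ |dot w ((1 : Matrix (Fin m) (Fin m) ℝ).mulVec w) -
        Matrix.trace ((1 : Matrix (Fin m) (Fin m) ℝ) * 1)|} ∪
      {w | ε / 2 ≤ |dot (fun _ : Fin m => 1 / (m : ℝ)) w|} := by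
    intro t ht
    by_contra hcon
    simp only [Set.mem_union, Set.mem_ofPred_eq, not_or, not_le] at hcon ht
    obtain ⟨c1, c2⟩ := hcon
    have f1 : dot t ((1 : Matrix (Fin m) (Fin m) ℝ).mulVec t) = ∑ i, t i ^ 2 := by
      rw [Matrix.one_mulVec]; simp [dot, sq]
    have f2 : dot (fun _ : Fin m => 1 / (m : ℝ)) t = (∑ i, t i) / m := by
      simp only [dot, ← Finset.mul_sum]; ring
    rw [f1, Matrix.one_mul, Matrix.trace_one, Fintype.card_fin] at c1
    rw [f2] at c2
    have hs := sdev_sq m hm t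
    have hs0 : 0 ≤ sdev m t := Real.sqrt_nonneg _
    generalize sdev m t = s at *
    generalize (∑ i, t i) / (m : ℝ) = c at *
    generalize ∑ i, t i ^ 2 = A at *
    have g1 : |A / m - 1| < ε / 2 := by
      have : A / m - 1 = (A - m) / m := by field_simp
      rw [this, abs_div, abs_of_pos hm', div_lt_iff₀ hm']; linarith
    rw [abs_lt] at g1 c2
    have g2 : c ^ 2 < ε / 2 := by nlinarith
    have g3 : |s ^ 2 - 1| < ε := by
      rw [hs, abs_lt]; constructor <;> nlinarith [sq_nonneg c]
    have g4 : |s - 1| ≤ |s ^ 2 - 1| := by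
      have : s ^ 2 - 1 = (s - 1) * (s + 1) := by ring
      rw [this, abs_mul]
      have : 1 ≤ |s + 1| := by rw [abs_of_nonneg (by linarith)]; linarith
      nlinarith [abs_nonneg (s - 1)]
    linarith
  calc _ ≤ _ := measureReal_mono hsub
    _ ≤ _ := measureReal_union_le _ _
    _ ≤ _ := add_le_add h1 h2
    _ = _ := by field_simp; norm_num

lemma unif (m : ℕ) (hm : 0 < m) {ε : ℝ} (hε : 0 < ε) (hε1 : ε < 1) (z a : ℝ) :
    |(Measure.pi fun _ : Fin m => gaussianReal 0 1).real
        {t | z < (Real.sqrt m * ((∑ i, t i) / m) + a) / sdev m t} - Φ (a - z)| ≤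
      |z| * ε + 12 / (m * ε ^ 2) := by
  have hm' : (0 : ℝ) < m := by positivity
  set G := Measure.pi fun _ : Fin m => gaussianReal 0 1
  have hbad := sdev_conc m hm hε hε1
  set B := {t : Fin m → ℝ | ε ≤ |sdev m t - 1|}
  have hlaw : G.map (fun t => Real.sqrt m * ((∑ i, t i) / m)) = gaussianReal 0 1 := by
    have := (gauss_vec m).2.2 (fun _ => Real.sqrt m / m)
    have e1 : (fun x => dot (fun _ : Fin m => Real.sqrt m / m) x) =
        fun t => Real.sqrt m * ((∑ i, t i) / m) := by
      ext t; simp only [dot, ← Finset.mul_sum]; ring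
    have e2 : dot (fun _ : Fin m => Real.sqrt m / m) 0 = 0 := dotProduct_zero _
    have e3 : dot (fun _ : Fin m => Real.sqrt m / m) ((1 : Matrix (Fin m) (Fin m) ℝ).mulVec
        (fun _ : Fin m => Real.sqrt m / m)) = 1 := by
      rw [Matrix.one_mulVec]; simp only [dot, Finset.sum_const, Finset.card_univ, Fintype.card_fin,
        nsmul_eq_mul]
      have := Real.mul_self_sqrt hm'.le
      field_simp
      nlinarith
    rw [e1, e2, e3, Real.toNNReal_one] at this
    exact this
  have htail : ∀ c, G.real {t | c < Real.sqrt m * ((∑ i, t i) / m)} = Φ (-c) := by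
    intro c
    rw [← gauss_Ioi, ← hlaw, map_measureReal_apply (by fun_prop) measurableSet_Ioi]
    rfl
  have hkey : ∀ t, t ∉ B → ∀ A : ℝ, 0 < sdev m t ∧ |z * sdev m t - z| ≤ |z| * ε := by
    intro t ht A
    simp only [B, Set.mem_ofPred_eq, not_le] at ht
    constructor
    · rw [abs_lt] at ht; linarith
    · have : z * sdev m t - z = z * (sdev m t - 1) := by ring
      rw [this, abs_mul]
      gcongr
  have up : G.real {t | z < (Real.sqrt m * ((∑ i, t i) / m) + a) / sdev m t} ≤
      Φ (-(z - |z| * ε - a)) + 12 / (m * ε ^ 2) := by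
    calc _ ≤ G.real ({t | z - |z| * ε - a < Real.sqrt m * ((∑ i, t i) / m)} ∪ B) := by
          refine measureReal_mono ?_ (measure_ne_top _ _)
          intro t ht
          by_cases hB : t ∈ B
          · exact Or.inr hB
          · left
            obtain ⟨k1, k2⟩ := hkey t hB 0
            simp only [Set.mem_ofPred_eq] at ht ⊢
            rw [lt_div_iff₀ k1] at ht
            rw [abs_le] at k2
            linarith
      _ ≤ _ := measureReal_union_le _ _
      _ ≤ _ := by rw [htail]; gcongr
  have lowr : Φ (-(z + |z| * ε - a)) ≤
      G.real {t | z < (Real.sqrt m * ((∑ i, t i) / m) + a) / sdev m t} + 12 / (m * ε ^ 2) := by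
    calc _ = G.real {t | z + |z| * ε - a < Real.sqrt m * ((∑ i, t i) / m)} := (htail _).symm
      _ ≤ G.real ({t | z < (Real.sqrt m * ((∑ i, t i) / m) + a) / sdev m t} ∪ B) := by
          refine measureReal_mono ?_ (measure_ne_top _ _)
          intro t ht
          by_cases hB : t ∈ B
          · exact Or.inr hB
          · left
            obtain ⟨k1, k2⟩ := hkey t hB 0
            simp only [Set.mem_ofPred_eq] at ht ⊢
            rw [lt_div_iff₀ k1]
            rw [abs_le] at k2
            linarith
      _ ≤ _ := measureReal_union_le _ _
      _ ≤ _ := by gcongr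
  have hz : 0 ≤ |z| * ε := by positivity
  have l1 := Phi_lip (-(z - |z| * ε - a)) (a - z)
  have l2 := Phi_lip (-(z + |z| * ε - a)) (a - z)
  have n1 : -(z - |z| * ε - a) - (a - z) = |z| * ε := by ring
  have n2 : -(z + |z| * ε - a) - (a - z) = -(|z| * ε) := by ring
  rw [n1, abs_of_nonneg hz, abs_le] at l1
  rw [n2, abs_neg, abs_of_nonneg hz, abs_le] at l2
  rw [abs_le]
  constructor <;> linarith

lemma stud_affine (m : ℕ) (hm : 0 < m) (t : Fin m → ℝ) (σ ν : ℝ) (hσ : 0 < σ) :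
    studentized m (fun i => σ * t i + ν) =
      (Real.sqrt m * ((∑ i, t i) / m) + Real.sqrt m * ν / σ) / sdev m t := by
  have hm' : (0 : ℝ) < m := by positivity
  unfold studentized sdev
  have e1 : (∑ i, (σ * t i + ν)) / (m : ℝ) = σ * ((∑ i, t i) / m) + ν := by
    rw [Finset.sum_add_distrib, ← Finset.mul_sum]; simp; field_simp
  rw [e1]
  generalize (∑ i, t i) / (m : ℝ) = c
  have e2 : ∀ i, (σ * t i + ν - (σ * c + ν)) ^ 2 = σ ^ 2 * (t i - c) ^ 2 := fun i => by ring
  simp_rw [e2]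
  rw [← Finset.mul_sum, mul_div_assoc (σ ^ 2), Real.sqrt_mul (sq_nonneg σ), Real.sqrt_sq hσ.le, ← div_div]
  congr 1
  field_simp

lemma stud_meas (m : ℕ) : Measurable (studentized m) := by
  unfold studentized; fun_prop

lemma cond_power {d : ℕ} (μ : Fin d → ℝ) (S : Matrix (Fin d) (Fin d) ℝ) (P : Measure (Fin d → ℝ))
    (hP : IsGaussianVec P μ S) (m : ℕ) (hm : 0 < m) {ε : ℝ} (hε : 0 < ε) (hε1 : ε < 1) (z : ℝ)
    (y : Fin d → ℝ) (hy : 0 < dot y (S.mulVec y)) :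
    |(Measure.pi fun _ : Fin m => P).real {ω | z < studentized m (fun i => dot y (ω i))} -
      Φ (Real.sqrt m * dot y μ / Real.sqrt (dot y (S.mulVec y)) - z)| ≤
      |z| * ε + 12 / (m * ε ^ 2) := by
  obtain ⟨hp, hSy, hg⟩ := hP
  set σ := Real.sqrt (dot y (S.mulVec y)) with hσ
  have hσ0 : 0 < σ := Real.sqrt_pos.2 hy
  have h1 : P.map (fun x => dot y x) = (gaussianReal 0 1).map (fun t => σ * t + dot y μ) := by
    have : (fun t => σ * t + dot y μ) = (fun t => t + dot y μ) ∘ (fun t => σ * t) := rfl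
    rw [hg, this, ← Measure.map_map (by fun_prop) (by fun_prop), gaussianReal_map_const_mul,
      gaussianReal_map_add_const]
    congr 1
    · simp
    · ext
      rw [Real.coe_toNNReal _ hy.le]
      simp [hσ, Real.sq_sqrt hy.le]
  have := hp
  have e1 : (Measure.pi fun _ : Fin m => P).map (fun ω i => dot y (ω i)) =
      (Measure.pi fun _ : Fin m => gaussianReal 0 1).map (fun t i => σ * t i + dot y μ) := by
    have : IsProbabilityMeasure (P.map (fun x => dot y x)) :=
      Measure.isProbabilityMeasure_map (dot_meas y).aemeasurable
    have : IsProbabilityMeasure ((gaussianReal 0 1).map (fun t => σ * t + dot y μ)) :=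
      Measure.isProbabilityMeasure_map (by fun_prop)
    rw [Measure.pi_map_pi (f := fun _ x => dot y x) (fun _ => (dot_meas y).aemeasurable),
      Measure.pi_map_pi (f := fun _ t => σ * t + dot y μ) (fun _ => by fun_prop), h1]
  have hms : MeasurableSet {x : Fin m → ℝ | z < studentized m x} :=
    measurableSet_lt measurable_const (stud_meas m)
  have hmd : Measurable (fun (ω : Fin m → Fin d → ℝ) i => dot y (ω i)) := by
    rw [measurable_pi_iff]; intro i; exact (dot_meas y).comp (measurable_pi_apply i)
  have e2 : (Measure.pi fun _ : Fin m => P).real {ω | z < studentized m (fun i => dot y (ω i))} =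
      (Measure.pi fun _ : Fin m => gaussianReal 0 1).real
        {t | z < (Real.sqrt m * ((∑ i, t i) / m) + Real.sqrt m * dot y μ / σ) / sdev m t} := by
    calc _ = ((Measure.pi fun _ : Fin m => P).map (fun ω i => dot y (ω i))).real
            {x : Fin m → ℝ | z < studentized m x} := by
          rw [map_measureReal_apply hmd hms]; rfl
      _ = _ := by
        rw [e1, map_measureReal_apply (by fun_prop) hms]
        congr 1
        ext t
        simp only [Set.mem_preimage, Set.mem_ofPred_eq]
        rw [stud_affine m hm t σ _ hσ0]
  rw [e2]
  exact unif m hm hε hε1 z _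

lemma mix {A B : Type*} [MeasurableSpace A] [MeasurableSpace B] (μ : Measure A) (ν : Measure B)
    [IsProbabilityMeasure μ] [IsProbabilityMeasure ν] (s : Set (A × B)) (hs : MeasurableSet s)
    (bad : Set A) (hb : MeasurableSet bad) (L ε δ : ℝ) (hL0 : 0 ≤ L) (hL1 : L ≤ 1) (hε : 0 ≤ ε)
    (hbad : μ.real bad ≤ δ)
    (h : ∀ x, x ∉ bad → |ν.real (Prod.mk x ⁻¹' s) - L| ≤ ε) :
    |(μ.prod ν).real s - L| ≤ ε + δ := by
  have hm : Measurable (fun x => ν.real (Prod.mk x ⁻¹' s)) :=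
    (measurable_measure_prodMk_left hs).ennreal_toReal
  have hbd : ∀ x, |ν.real (Prod.mk x ⁻¹' s)| ≤ 1 := fun x => by
    rw [abs_of_nonneg measureReal_nonneg]; exact measureReal_le_one
  have hI : Integrable (fun x => ν.real (Prod.mk x ⁻¹' s)) μ :=
    Integrable.of_bound hm.aestronglyMeasurable 1 (ae_of_all _ hbd)
  have e : (μ.prod ν).real s = ∫ x, ν.real (Prod.mk x ⁻¹' s) ∂μ := by
    rw [measureReal_def, Measure.prod_apply hs, integral_eq_lintegral_of_nonneg_ae
      (ae_of_all _ fun x => measureReal_nonneg) hm.aestronglyMeasurable]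
    congr 1
    refine lintegral_congr fun x => ?_
    rw [ofReal_measureReal]
  have e2 : (μ.prod ν).real s - L = ∫ x, (ν.real (Prod.mk x ⁻¹' s) - L) ∂μ := by
    rw [e, integral_sub hI (integrable_const _)]; simp
  have hI2 : Integrable (fun x => bad.indicator (fun _ => (1:ℝ)) x) μ :=
    (integrable_const 1).indicator hb
  rw [e2]
  calc _ ≤ ∫ x, |ν.real (Prod.mk x ⁻¹' s) - L| ∂μ := abs_integral_le_integral_abs
    _ ≤ ∫ x, (ε + bad.indicator (fun _ => (1:ℝ)) x) ∂μ := by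
        refine integral_mono (hI.sub (integrable_const L)).abs ((integrable_const ε).add hI2) ?_
        intro x
        by_cases hx : x ∈ bad
        · simp only [hx, Set.indicator_of_mem]
          have h1 := hbd x
          have h2 : 0 ≤ ν.real (Prod.mk x ⁻¹' s) := measureReal_nonneg
          rw [abs_of_nonneg h2] at h1
          rw [abs_le]; constructor <;> linarith
        · simp only [hx, not_false_eq_true, Set.indicator_of_notMem, add_zero]
          exact h x hx
    _ = ε + μ.real bad := by
        rw [integral_add (integrable_const ε) hI2, integral_indicator_const _ hb]; simp
    _ ≤ _ := by linarith

set_option linter.unusedVariables false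

lemma ratio_bd (c K δ r r0 ν ν0 : ℝ) (hc : 0 < c) (hr0 : 2 * c ≤ r0) (hδ : δ ≤ c)
    (hK : |ν0| ≤ K) (h1 : |ν - ν0| ≤ δ) (h2 : |r - r0| ≤ δ) :
    0 < r ∧ |ν / Real.sqrt r - ν0 / Real.sqrt r0| ≤ δ * (1 / Real.sqrt c + K / (c * Real.sqrt c)) := by
  have hrc : c ≤ r := by rw [abs_le] at h2; linarith
  have hr : 0 < r := by linarith
  have hδ0 : 0 ≤ δ := (abs_nonneg _).trans h1
  refine ⟨hr, ?_⟩
  have s1 : Real.sqrt c ≤ Real.sqrt r := Real.sqrt_le_sqrt hrc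
  have s2 : Real.sqrt c ≤ Real.sqrt r0 := Real.sqrt_le_sqrt (by linarith)
  have sc : 0 < Real.sqrt c := Real.sqrt_pos.2 hc
  have q0 := Real.sq_sqrt hc.le
  have q1 := Real.sq_sqrt hr.le
  have q2 := Real.sq_sqrt (show 0 ≤ r0 by linarith)
  generalize Real.sqrt c = x at *
  generalize Real.sqrt r = y at *
  generalize Real.sqrt r0 = w at *
  have hy : 0 < y := by linarith
  have hw : 0 < w := by linarith
  have e : ν / y - ν0 / w = (ν - ν0) / y + ν0 * (r0 - r) / (y * w * (y + w)) := by
    rw [← q1, ← q2]; field_simp; ring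
  rw [e]
  have b1 : |(ν - ν0) / y| ≤ δ / x := by
    rw [abs_div, abs_of_pos hy]
    gcongr
  have b2 : |ν0 * (r0 - r) / (y * w * (y + w))| ≤ K * δ / (x * x * x) := by
    rw [abs_div, abs_mul, abs_sub_comm r0, abs_of_pos (by positivity : 0 < y * w * (y + w))]
    have hK0 : 0 ≤ K := (abs_nonneg _).trans hK
    gcongr
    linarith
  calc _ ≤ _ := abs_add_le _ _
    _ ≤ δ / x + K * δ / (x * x * x) := add_le_add b1 b2
    _ = _ := by rw [← q0]; field_simp

lemma form_cross {d : ℕ} (S : Matrix (Fin d) (Fin d) ℝ) (hS : S.IsSymm)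
    (hpos : ∀ x, 0 ≤ dot x (S.mulVec x)) (x w : Fin d → ℝ) (s δ : ℝ) (hδ : 0 < δ) :
    dot (x + s • w) (S.mulVec (x + s • w)) =
      dot x (S.mulVec x) + 2 * s * dot x (S.mulVec w) + s ^ 2 * dot w (S.mulVec w) ∧
    |2 * s * dot x (S.mulVec w)| ≤ dot x (S.mulVec x) / δ + δ * (s ^ 2 * dot w (S.mulVec w)) := by
  have hsym : dot w (S.mulVec x) = dot x (S.mulVec w) := by
    have h1 : dot w (S.mulVec x) = w ⬝ᵥ S.mulVec x := rfl
    have h2 : dot x (S.mulVec w) = x ⬝ᵥ S.mulVec w := rfl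
    rw [h1, h2, Matrix.dotProduct_mulVec, ← Matrix.mulVec_transpose, hS.eq, dotProduct_comm]
  have hexp : ∀ s : ℝ, dot (x + s • w) (S.mulVec (x + s • w)) =
      dot x (S.mulVec x) + 2 * s * dot x (S.mulVec w) + s ^ 2 * dot w (S.mulVec w) := by
    intro s
    rw [Matrix.mulVec_add, Matrix.mulVec_smul, dot_add_left, dot_add_right, dot_add_right,
      dot_smul_left, dot_smul_left, dot_smul_right, dot_smul_right, hsym]
    ring
  refine ⟨hexp s, ?_⟩
  have p1 := hpos (x + (δ * s) • w)
  have p2 := hpos (x + (-(δ * s)) • w)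
  rw [hexp] at p1 p2
  generalize dot x (S.mulVec x) = a at *
  generalize dot x (S.mulVec w) = b at *
  generalize dot w (S.mulVec w) = e at *
  have : a / δ + δ * (s ^ 2 * e) = (a + δ ^ 2 * s ^ 2 * e) / δ := by field_simp
  rw [this, le_div_iff₀ hδ, ← abs_of_pos hδ, ← abs_mul, abs_of_pos hδ, abs_le]
  constructor <;> nlinarith

lemma Phi_01 (x : ℝ) : 0 ≤ Φ x ∧ Φ x ≤ 1 := by
  rw [Phi_eq]; exact ⟨measureReal_nonneg, measureReal_le_one⟩

set_option maxHeartbeats 4000000 in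
lemma core {d m₁ m₂ : ℕ} (hd : 0 < d) (hm1 : 0 < m₁) (hm2 : 0 < m₂)
    (μ : Fin d → ℝ) (S : Matrix (Fin d) (Fin d) ℝ) (P : Measure (Fin d → ℝ))
    (hP : IsGaussianVec P μ S) (lo hi : ℝ) (hlo : 0 < lo)
    (heig : ∀ u : Fin d → ℝ, dot u u = 1 → lo ≤ dot u (S.mulVec u) ∧ dot u (S.mulVec u) ≤ hi)
    (z K ν0 δ : ℝ) (hδ : 0 < δ) (hδ1 : δ < 1) (hδ2 : δ * (hi ^ 2 + 5) ≤ lo ^ 2 / 2)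
    (hK : |ν0| ≤ K)
    (hν : |Real.sqrt m₁ * Real.sqrt m₂ / Real.sqrt d * dot μ μ - ν0| ≤ δ)
    (hp2 : m₂ * dot μ (S.mulVec μ) / d ≤ δ ^ 2)
    (hp1 : m₁ * dot μ (S.mulVec μ) / d ≤ δ ^ 3)
    (hq : 2 * hi ^ 4 / (d * δ ^ 2) ≤ δ)
    (hm : 12 / (m₁ * δ ^ 2) ≤ δ) :
    |(Measure.pi fun _ : Fin (m₁ + m₂) => P).real {ω | z < Tmean d m₁ m₂ ω} -
      Φ (ν0 / Real.sqrt (Matrix.trace (S * S) / d) - z)| ≤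
    δ * (|z| + 3 + (hi ^ 2 + 5) * (1 / Real.sqrt (lo ^ 2 / 2) +
      K / (lo ^ 2 / 2 * Real.sqrt (lo ^ 2 / 2)))) := by
  have hpr := hP.1
  have hSy := hP.2.1
  have hd' : (0 : ℝ) < d := by positivity
  have hm1' : (0 : ℝ) < m₁ := by positivity
  have hm2' : (0 : ℝ) < m₂ := by positivity
  have sd := Real.sqrt_pos.2 hd'
  have s1 := Real.sqrt_pos.2 hm1'
  have s2 := Real.sqrt_pos.2 hm2'
  have hpos : ∀ x, 0 ≤ dot x (S.mulVec x) := fun x => (form_bd S hSy lo hi hlo heig x).1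
  have htr := trace_bd S hSy lo hi hlo heig
  set C := (1 / Real.sqrt (lo ^ 2 / 2) + K / (lo ^ 2 / 2 * Real.sqrt (lo ^ 2 / 2))) with hC
  set r0 := Matrix.trace (S * S) / d with hr0
  have hr0a : lo ^ 2 ≤ r0 := by rw [hr0, le_div_iff₀ hd']; linarith [htr.1]
  have hr0b : r0 ≤ hi ^ 2 := by rw [hr0, div_le_iff₀ hd']; linarith [htr.2]
  set ybar : (Fin m₂ → Fin d → ℝ) → Fin d → ℝ := fun ω j => (∑ k, ω k j) / m₂ with hyb
  have hyW : ∀ ω, ybar ω = μ + (1 / Real.sqrt m₂) • Wfun μ m₂ ω := by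
    intro ω; ext j
    simp only [hyb, Wfun, Pi.add_apply, Pi.smul_apply, smul_eq_mul]
    rw [Finset.sum_sub_distrib]
    simp only [Finset.sum_const, Finset.card_univ, Fintype.card_fin, nsmul_eq_mul]
    have := Real.mul_self_sqrt hm2'.le
    field_simp
    rw [sq, this]; ring
  have hybm : Measurable ybar := by simp only [hyb]; fun_prop
  have hL := W_law μ S P hP hpos m₂ hm2
  set L := (Measure.pi fun _ : Fin m₂ => P).map (Wfun μ m₂) with hLdef
  set E1 : Set (Fin d → ℝ) := {w | δ * (Real.sqrt d / Real.sqrt m₁) ≤ |dot μ w|} with hE1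
  set E2 : Set (Fin d → ℝ) := {w | d * δ ≤ |dot w (S.mulVec w) - Matrix.trace (S * S)|} with hE2
  have c1 : L.real E1 ≤ δ := by
    refine (lin_conc S L hL μ (hpos μ) (by positivity)).trans ?_
    rw [div_le_iff₀ (by positivity), mul_pow, div_pow, Real.sq_sqrt hd'.le, Real.sq_sqrt hm1'.le]
    rw [div_le_iff₀ hd'] at hp1
    have e : δ * (δ ^ 2 * (d / m₁)) = δ ^ 3 * d / m₁ := by ring
    rw [e, le_div_iff₀ hm1']
    linarith
  have c2 : L.real E2 ≤ δ := by
    refine (quad_conc S L hL lo hi hlo heig (by positivity)).trans (le_trans (le_of_eq ?_) hq)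
    field_simp
  have mE1 : MeasurableSet E1 := measurableSet_le measurable_const (dot_meas μ).abs
  have mE2 : MeasurableSet E2 := by
    refine measurableSet_le measurable_const (Measurable.abs (Measurable.sub_const ?_ _))
    unfold dot Matrix.mulVec dotProduct
    fun_prop
  have mW := Wfun_meas μ m₂
  have hTmeas : Measurable (fun p : (Fin m₂ → Fin d → ℝ) × (Fin m₁ → Fin d → ℝ) =>
      studentized m₁ (fun i => dot (ybar p.1) (p.2 i))) := by
    refine (stud_meas m₁).comp ?_
    unfold dot
    fun_prop
  set s : Set ((Fin m₂ → Fin d → ℝ) × (Fin m₁ → Fin d → ℝ)) :=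
    {p | z < studentized m₁ (fun i => dot (ybar p.1) (p.2 i))} with hs
  have hsm : MeasurableSet s := measurableSet_lt measurable_const hTmeas
  have hpow : (Measure.pi fun _ : Fin (m₁ + m₂) => P).real {ω | z < Tmean d m₁ m₂ ω} =
      ((Measure.pi fun _ : Fin m₂ => P).prod (Measure.pi fun _ : Fin m₁ => P)).real s := by
    have hmeas : Measurable (fun p : (Fin m₂ → Fin d → ℝ) × (Fin m₁ → Fin d → ℝ) =>
        Fin.append p.2 p.1) := by
      rw [measurable_pi_iff]
      intro i
      refine Fin.addCases (fun j => ?_) (fun j => ?_) i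
      · simp only [Fin.append_left]; fun_prop
      · simp only [Fin.append_right]; fun_prop
    have hTm : Measurable (Tmean d m₁ m₂) := by
      refine (stud_meas m₁).comp ?_
      unfold dot
      fun_prop
    rw [← split_map P m₁ m₂, map_measureReal_apply hmeas (measurableSet_lt measurable_const hTm)]
    congr 1
    ext p
    simp only [Set.mem_preimage, Set.mem_ofPred_eq, hs, Tmean, Fin.append_left, Fin.append_right, hyb]
  rw [hpow]
  have hΦ := Phi_01 (ν0 / Real.sqrt r0 - z)
  have hC0 : 0 ≤ C := by
    have : 0 ≤ K := (abs_nonneg _).trans hK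
    positivity
  have hmain := mix (Measure.pi fun _ : Fin m₂ => P) (Measure.pi fun _ : Fin m₁ => P) s hsm
    (Wfun μ m₂ ⁻¹' (E1 ∪ E2)) (mW (mE1.union mE2)) (Φ (ν0 / Real.sqrt r0 - z))
    (|z| * δ + δ + δ * (hi ^ 2 + 5) * C) (δ + δ) hΦ.1 hΦ.2 (by positivity) ?_ ?_
  · refine hmain.trans (le_of_eq ?_); ring
  · rw [← map_measureReal_apply mW (mE1.union mE2)]
    exact (measureReal_union_le _ _).trans (add_le_add c1 c2)
  intro ω hω
  simp only [Set.mem_preimage, Set.mem_union, not_or, hE1, hE2, Set.mem_ofPred_eq, not_le] at hω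
  obtain ⟨g1, g2⟩ := hω
  set w := Wfun μ m₂ ω with hw
  have hy := hyW ω
  rw [← hw] at hy
  set y := ybar ω with hydef
  obtain ⟨f1, f2⟩ := form_cross S hSy hpos μ w (1 / Real.sqrt m₂) δ hδ
  rw [← hy] at f1
  have hsq : (1 / Real.sqrt m₂) ^ 2 = 1 / (m₂ : ℝ) := by
    rw [div_pow, Real.sq_sqrt hm2'.le, one_pow]
  rw [hsq] at f1 f2
  have hyμ : dot y μ = dot μ μ + 1 / Real.sqrt m₂ * dot μ w := by
    rw [hy, dot_add_left, dot_smul_left, dot_comm' w]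
  have hrr : |m₂ * dot y (S.mulVec y) / d - r0| ≤ δ * (hi ^ 2 + 5) := by
    set q := dot w (S.mulVec w) / d with hq'
    set p := m₂ * dot μ (S.mulVec μ) / d with hp'
    set X := m₂ * (2 * (1 / Real.sqrt m₂) * dot μ (S.mulVec w)) / d with hX
    have e1 : m₂ * dot y (S.mulVec y) / d = p + X + q := by
      rw [f1, hq', hp', hX]; field_simp
    have e2 : |X| ≤ p / δ + δ * q := by
      rw [hX, mul_div_right_comm, abs_mul, abs_of_pos (by positivity : (0:ℝ) < m₂ / d)]
      calc _ ≤ (m₂ / d : ℝ) * (dot μ (S.mulVec μ) / δ + δ * (1 / m₂ * dot w (S.mulVec w))) := by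
            gcongr
        _ = _ := by rw [hq', hp']; field_simp
    have e3 : |q - r0| ≤ δ := by
      rw [hq', hr0, ← sub_div, abs_div, abs_of_pos hd', div_le_iff₀ hd']
      linarith
    have p0 : 0 ≤ p := by have := hpos μ; positivity
    have e4 : p / δ ≤ δ := by rw [div_le_iff₀ hδ, ← sq]; exact hp2
    have e5 : δ * q ≤ δ * (hi ^ 2 + 1) := by
      gcongr; rw [abs_le] at e3; linarith
    have e6 : p ≤ δ := hp2.trans (by rw [sq]; exact mul_le_of_le_one_left hδ.le hδ1.le)
    have e7 : 0 ≤ δ * hi ^ 2 := by positivity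
    rw [e1]
    rw [abs_le] at e2 e3 ⊢
    rw [mul_add] at e5 ⊢
    constructor <;> linarith [e2.1, e2.2, e3.1, e3.2]
  have hnn : |Real.sqrt m₁ * Real.sqrt m₂ / Real.sqrt d * dot y μ - ν0| ≤ δ * (hi ^ 2 + 5) := by
    have e1 : Real.sqrt m₁ * Real.sqrt m₂ / Real.sqrt d * dot y μ =
        Real.sqrt m₁ * Real.sqrt m₂ / Real.sqrt d * dot μ μ + Real.sqrt m₁ / Real.sqrt d * dot μ w := by
      rw [hyμ]; field_simp
    have e2 : |Real.sqrt m₁ / Real.sqrt d * dot μ w| ≤ δ := by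
      rw [abs_mul, abs_of_pos (by positivity : 0 < Real.sqrt m₁ / Real.sqrt d)]
      calc _ ≤ Real.sqrt m₁ / Real.sqrt d * (δ * (Real.sqrt d / Real.sqrt m₁)) := by gcongr
        _ = δ := by field_simp
    rw [e1]
    rw [abs_le] at e2 hν ⊢
    have e7 : 0 ≤ δ * hi ^ 2 := by positivity
    rw [mul_add]
    constructor <;> linarith [e2.1, e2.2, hν.1, hν.2]
  obtain ⟨hr, hrat⟩ := ratio_bd (lo ^ 2 / 2) K (δ * (hi ^ 2 + 5)) _ r0 _ ν0 (by positivity)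
    (by linarith) hδ2 hK hnn hrr
  have hyS : 0 < dot y (S.mulVec y) := by
    by_contra hcon
    have : dot y (S.mulVec y) = 0 := le_antisymm (not_lt.1 hcon) (hpos y)
    rw [this] at hr
    simp at hr
  have sy := Real.sqrt_pos.2 hyS
  have hcp := cond_power μ S P hP m₁ hm1 hδ hδ1 z y hyS
  have ea : Real.sqrt m₁ * Real.sqrt m₂ / Real.sqrt d * dot y μ /
      Real.sqrt (m₂ * dot y (S.mulVec y) / d) =
      Real.sqrt m₁ * dot y μ / Real.sqrt (dot y (S.mulVec y)) := by
    rw [Real.sqrt_div (by positivity), Real.sqrt_mul hm2'.le]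
    field_simp
  rw [ea] at hrat
  have hlip := Phi_lip (Real.sqrt m₁ * dot y μ / Real.sqrt (dot y (S.mulVec y)) - z)
    (ν0 / Real.sqrt r0 - z)
  rw [sub_sub_sub_cancel_right] at hlip
  have hset : Prod.mk ω ⁻¹' s = {ω' | z < studentized m₁ (fun i => dot y (ω' i))} := rfl
  rw [hset]
  rw [← hC] at hrat
  calc _ ≤ _ := abs_sub_le _ (Φ (Real.sqrt m₁ * dot y μ / Real.sqrt (dot y (S.mulVec y)) - z)) _
    _ ≤ (|z| * δ + δ) + δ * (hi ^ 2 + 5) * C := by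
      refine add_le_add (hcp.trans ?_) (hlip.trans hrat)
      gcongr
    _ = _ := by ring

lemma dot_self_nonneg' {d : ℕ} (x : Fin d → ℝ) : 0 ≤ dot x x :=
  Finset.sum_nonneg fun i _ => mul_self_nonneg (x i)

theorem cross_mean_asymptotic_power
    (α : ℝ) (hα : 0 < α ∧ α < 1)
    (d m₁ : ℕ → ℕ) (hm : ∀ n, m₁ n ≤ n)
    (μv : ∀ n, Fin (d n) → ℝ) (S : ∀ n, Matrix (Fin (d n)) (Fin (d n)) ℝ)
    (P : ∀ n, Measure (Fin (d n) → ℝ))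
    -- (a) Gaussianity
    (hP : ∀ n, IsGaussianVec (P n) (μv n) (S n))
    -- (b) bounded eigenvalues: λ_* ≤ uᵀΣu ≤ λ^* for all unit vectors u
    (lamlo lamhi : ℝ) (hlo : 0 < lamlo)
    (heig : ∀ n, ∀ u : Fin (d n) → ℝ, dot u u = 1 →
      lamlo ≤ dot u ((S n).mulVec u) ∧ dot u ((S n).mulVec u) ≤ lamhi)
    -- (c) local alternatives: μᵀμ = O(√d/n)
    (hloc : ∃ C : ℝ, ∀ n, dot (μv n) (μv n) ≤ C * Real.sqrt (d n) / n)
    -- (d) dimension-to-sample-size ratio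
    (τ : ℝ) (hτ : 0 < τ)
    (hd : Tendsto (fun n => (d n : ℝ) / n) atTop (nhds τ))
    -- (e) sample-splitting ratio
    (κ : ℝ) (hκ : 0 < κ ∧ κ < 1)
    (hm1 : Tendsto (fun n => (m₁ n : ℝ) / n) atTop (nhds κ))
    -- the Gaussian quantiles z_{1-α} and z_α
    (z1a za : ℝ) (hz1 : Φ z1a = 1 - α) (hza : Φ za = α) :
    Tendsto (fun n =>
        ((Measure.pi fun _ : Fin (m₁ n + (n - m₁ n)) => P n)
            {ω | z1a < Tmean (d n) (m₁ n) (n - m₁ n) ω}).toReal -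
          Φ (za + n * Real.sqrt (κ * (1 - κ)) * dot (μv n) (μv n) /
              Real.sqrt (Matrix.trace (S n * S n))))
      atTop (nhds 0) ∧
    -- the factor √(κ(1−κ)) is maximized at κ = 1/2
    ∀ κ' : ℝ, 0 < κ' → κ' < 1 →
      Real.sqrt (κ' * (1 - κ')) ≤ Real.sqrt ((1 / 2) * (1 - 1 / 2)) := by
  refine ⟨?_, fun κ' _ _ => Real.sqrt_le_sqrt (by nlinarith [sq_nonneg (κ' - 1 / 2)])⟩
  obtain ⟨C, hC⟩ := hloc
  rw [quant_neg α z1a za hz1 hza]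
  set k := Real.sqrt (κ * (1 - κ)) with hk
  have hk0 : 0 ≤ k := Real.sqrt_nonneg _
  set M := |z1a| + 3 + (lamhi ^ 2 + 5) * (1 / Real.sqrt (lamlo ^ 2 / 2) +
      (k * |C|) / (lamlo ^ 2 / 2 * Real.sqrt (lamlo ^ 2 / 2))) with hM
  have hM0 : 0 < M := by positivity
  have hnat : Tendsto (fun n : ℕ => (n : ℝ)) atTop atTop := tendsto_natCast_atTop_atTop
  have mulback : ∀ (a : ℕ → ℕ) (c : ℝ), 0 < c →
      Tendsto (fun n => (a n : ℝ) / n) atTop (nhds c) →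
      Tendsto (fun n => (a n : ℝ)) atTop atTop := by
    intro a c hc h
    refine (h.pos_mul_atTop hc hnat).congr' ?_
    filter_upwards [eventually_gt_atTop 0] with n hn
    have : (n : ℝ) ≠ 0 := by positivity
    field_simp
  have hdt := mulback d τ hτ hd
  have hm1t := mulback m₁ κ hκ.1 hm1
  have hm2 : Tendsto (fun n => ((n - m₁ n : ℕ) : ℝ) / n) atTop (nhds (1 - κ)) := by
    refine (hm1.const_sub 1).congr' ?_
    filter_upwards [eventually_gt_atTop 0] with n hn
    have : (n : ℝ) ≠ 0 := by positivity
    rw [Nat.cast_sub (hm n)]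
    field_simp
  have hm2t := mulback (fun n => n - m₁ n) (1 - κ) (by linarith [hκ.2]) hm2
  have hkt : Tendsto (fun n => Real.sqrt ((m₁ n : ℝ) / n * (((n - m₁ n : ℕ) : ℝ) / n)))
      atTop (nhds k) := (Real.continuous_sqrt.tendsto _).comp (hm1.mul hm2)
  have hsd : Tendsto (fun n => Real.sqrt (d n : ℝ)) atTop atTop :=
    Real.tendsto_sqrt_atTop.comp hdt
  have hsmall : Tendsto (fun n => |lamhi| * |C| / Real.sqrt (d n : ℝ)) atTop (nhds 0) :=
    hsd.const_div_atTop _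
  rw [Metric.tendsto_nhds]
  intro η hη
  obtain ⟨δ, hδ, hδ1, hδ2, hδ3⟩ : ∃ δ : ℝ, 0 < δ ∧ δ < 1 ∧
      δ * (lamhi ^ 2 + 5) ≤ lamlo ^ 2 / 2 ∧ δ * M < η := by
    refine ⟨min (1 / 2) (min (lamlo ^ 2 / 2 / (lamhi ^ 2 + 5)) (η / M / 2)), by positivity, ?_, ?_, ?_⟩
    · exact (min_le_left _ _).trans_lt (by norm_num)
    · rw [← le_div_iff₀ (by positivity)]
      exact (min_le_right _ _).trans (min_le_left _ _)
    · rw [← lt_div_iff₀ hM0]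
      refine ((min_le_right _ _).trans (min_le_right _ _)).trans_lt ?_
      exact half_lt_self (by positivity)
  have hcl : ∀ᶠ n in atTop,
      |Real.sqrt ((m₁ n : ℝ) / n * (((n - m₁ n : ℕ) : ℝ) / n)) - k| < δ / (|C| + 1) := by
    have := (Metric.tendsto_nhds.1 hkt) (δ / (|C| + 1)) (by positivity)
    simpa only [Real.dist_eq] using this
  filter_upwards [eventually_gt_atTop 0, hcl, hdt.eventually_gt_atTop 0,
    hm1t.eventually_gt_atTop 0, hm2t.eventually_gt_atTop 0,
    hsmall.eventually_le_const (show (0 : ℝ) < δ ^ 3 by positivity),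
    hdt.eventually_ge_atTop (2 * lamhi ^ 4 / δ ^ 3),
    hm1t.eventually_ge_atTop (12 / δ ^ 3)] with n hn0 h1 hdn hm1n hm2n h3 h4 h5
  have hn : (0 : ℝ) < n := by positivity
  have sd : 0 < Real.sqrt (d n : ℝ) := Real.sqrt_pos.2 hdn
  have hsq : Real.sqrt (d n : ℝ) * Real.sqrt (d n : ℝ) = d n := Real.mul_self_sqrt hdn.le
  have hμ0 := dot_self_nonneg' (μv n)
  have hA : (n : ℝ) * dot (μv n) (μv n) / Real.sqrt (d n) ≤ |C| := by
    rw [div_le_iff₀ sd]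
    have := hC n
    rw [le_div_iff₀ hn] at this
    nlinarith [le_abs_self C]
  have hA0 : 0 ≤ (n : ℝ) * dot (μv n) (μv n) / Real.sqrt (d n) := by positivity
  have hform := form_bd (S n) (hP n).2.1 lamlo lamhi hlo (heig n) (μv n)
  have hmS : ∀ m : ℝ, 0 ≤ m → m ≤ n →
      m * dot (μv n) ((S n).mulVec (μv n)) / d n ≤ δ ^ 3 := by
    intro m hm0 hmn
    refine le_trans ?_ h3
    calc m * dot (μv n) ((S n).mulVec (μv n)) / d n
        ≤ n * (|lamhi| * dot (μv n) (μv n)) / d n := by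
          have := hform.1
          gcongr
          exact hform.2.trans (mul_le_mul_of_nonneg_right (le_abs_self _) hμ0)
      _ = |lamhi| * ((n : ℝ) * dot (μv n) (μv n) / Real.sqrt (d n)) / Real.sqrt (d n) := by
          rw [mul_div_assoc', div_div, hsq]; ring
      _ ≤ _ := by gcongr
  have hm1le : (m₁ n : ℝ) ≤ n := by exact_mod_cast hm n
  have hm2le : ((n - m₁ n : ℕ) : ℝ) ≤ n := by exact_mod_cast Nat.sub_le _ _
  have hcore := core (d := d n) (m₁ := m₁ n) (m₂ := n - m₁ n) (by exact_mod_cast hdn)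
    (by exact_mod_cast hm1n) (by exact_mod_cast hm2n) (μv n) (S n) (P n) (hP n) lamlo lamhi hlo
    (heig n) z1a (k * |C|) (k * ((n : ℝ) * dot (μv n) (μv n) / Real.sqrt (d n))) δ hδ hδ1 hδ2
    (by rw [abs_of_nonneg (by positivity)]; gcongr) ?_
    ((hmS _ hm2n.le hm2le).trans (pow_le_pow_of_le_one hδ.le hδ1.le (by norm_num)))
    (hmS _ hm1n.le hm1le) ?_ ?_
  · rw [Real.dist_eq, sub_zero]
    refine lt_of_le_of_lt (le_of_eq ?_) (hcore.trans_lt hδ3)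
    have e : -z1a + n * k * dot (μv n) (μv n) / Real.sqrt (Matrix.trace (S n * S n)) =
        k * ((n : ℝ) * dot (μv n) (μv n) / Real.sqrt (d n)) /
          Real.sqrt (Matrix.trace (S n * S n) / d n) - z1a := by
      rw [Real.sqrt_div' _ hdn.le]
      rcases eq_or_ne (Real.sqrt (Matrix.trace (S n * S n))) 0 with h0 | h0
      · rw [h0]; simp
      · field_simp; ring
    rw [e]
    rfl
  · have e : Real.sqrt (m₁ n) * Real.sqrt ((n - m₁ n : ℕ) : ℝ) / Real.sqrt (d n) *
        dot (μv n) (μv n) - k * ((n : ℝ) * dot (μv n) (μv n) / Real.sqrt (d n)) =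
        (Real.sqrt ((m₁ n : ℝ) / n * (((n - m₁ n : ℕ) : ℝ) / n)) - k) *
          ((n : ℝ) * dot (μv n) (μv n) / Real.sqrt (d n)) := by
      rw [div_mul_div_comm, Real.sqrt_div (by positivity), Real.sqrt_mul_self hn.le,
        Real.sqrt_mul hm1n.le]
      field_simp
    rw [e, abs_mul, abs_of_nonneg hA0]
    calc _ ≤ δ / (|C| + 1) * (|C| + 1) := by
          refine mul_le_mul h1.le (hA.trans (by linarith)) hA0 (by positivity)
      _ = δ := by field_simp
  · rw [div_le_iff₀ (by positivity)] at h4 ⊢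
    linarith
  · rw [div_le_iff₀ (by positivity)] at h5 ⊢
    linarith

end
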